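/- arXiv:2005.08301 — 8 statements merged into one kernel-verified Lean document; each statement's English description precedes it below -/
import Mathlib

section
/- Let k ≥ 3 be an integer, let G be a weighted multigraph on a vertex set V with |V| = n ≥ k, set r = ⌈k/2⌉, and let T_1, …, T_r ⊆ V be (shores of) medium cuts. Then at least one of the following holds: |Venn(T_1, …, T_{r−1})| < 2(r−1), or |Venn(T_1, …, T_r)| < 2r. -/
open Finset

/-- The weight of a `k`-cut, viewed as a finite partition `P` of the vertex set:
the sum of `w u v` over unordered pairs `{u, v}` lying in different parts. -/
noncomputable def kCutWeight {V : Type*} [Fintype V] [DecidableEq V] (w : V → V → ℝ)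
    (P : Finpartition (univ : Finset V)) : ℝ :=
  (1 / 2) * ∑ u, ∑ v, if ∃ p ∈ P.parts, u ∈ p ∧ v ∈ p then (0 : ℝ) else w u v

/-- The weight `∂S` of the 2-cut with shore `S`. -/
noncomputable def cutW {V : Type*} [Fintype V] [DecidableEq V] (w : V → V → ℝ)
    (S : Finset V) : ℝ :=
  ∑ u ∈ S, ∑ v ∈ Sᶜ, w u v

/-- `vennCard F` is the number of atoms of the Venn diagram of the sets `F 0, …, F (t-1)`:
the number of sign patterns `g : Fin t → Bool` whose corresponding region
`⋂ i, (if g i then F i else (F i)ᶜ)` is nonempty. -/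
def vennCard {V : Type*} [Fintype V] [DecidableEq V] {t : ℕ} (F : Fin t → Finset V) : ℕ :=
  (univ.filter fun g : Fin t → Bool =>
    (univ.filter fun v : V => ∀ i, (v ∈ F i ↔ g i = true)).Nonempty).card

/-- The weight of the cut induced by a labelling `f` of the vertices. -/
noncomputable def labelCutWeight {V α : Type*} [Fintype V] [DecidableEq α] (w : V → V → ℝ)
    (f : V → α) : ℝ :=
  (1 / 2) * ∑ u, ∑ v, if f u = f v then (0 : ℝ) else w u v

theorem le_labelCutWeight_of_surjective {V : Type*} [Fintype V] [DecidableEq V]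
    {w : V → V → ℝ} {lam : ℝ} {k : ℕ}
    (hmin : ∀ P : Finpartition (univ : Finset V), P.parts.card = k → lam ≤ kCutWeight w P)
    {g : V → Fin k} (hg : Function.Surjective g) : lam ≤ labelCutWeight w g := by
  let c : Fin k → Finset V := fun i => univ.filter fun v => g v = i
  have hc : ∀ i v, v ∈ c i ↔ g v = i := by simp [c]
  have hinj : Function.Injective c := by
    intro i j hij
    obtain ⟨v, hv⟩ := hg i
    rw [← hv]
    exact (hc j v).1 (hij ▸ (hc i v).2 hv)
  let P : Finpartition (univ : Finset V) :=
    Finpartition.ofExistsUnique (univ.image c) (fun _ _ => subset_univ _)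
      (fun v _ => ⟨c (g v), by simp [hc], by
        rintro t ⟨ht, hvt⟩
        obtain ⟨i, -, rfl⟩ := mem_image.1 ht
        rw [(hc i v).1 hvt]⟩)
      (fun h => by
        obtain ⟨i, -, hi⟩ := mem_image.1 h
        obtain ⟨v, hv⟩ := hg i
        exact notMem_empty v (hi ▸ (hc i v).2 hv))
  have hP : P.parts = univ.image c := rfl
  have key := hmin P (by rw [hP, card_image_of_injective _ hinj, card_univ, Fintype.card_fin])
  refine key.trans_eq ?_
  unfold kCutWeight labelCutWeight
  congr! 5 with u _ v _
  rw [hP]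
  simp [hc, eq_comm]

theorem labelCutWeight_comp_le {V α β : Type*} [Fintype V] [DecidableEq α] [DecidableEq β]
    {w : V → V → ℝ} (hnonneg : ∀ u v, 0 ≤ w u v) (f : V → α) (h : α → β) :
    labelCutWeight w (h ∘ f) ≤ labelCutWeight w f := by
  unfold labelCutWeight
  gcongr with u _ v _
  have := hnonneg u v
  by_cases huv : f u = f v
  · simp [huv]
  · rw [if_neg huv]
    split_ifs <;> simp [this]

theorem le_labelCutWeight {V α : Type*} [Fintype V] [DecidableEq V] [DecidableEq α]
    {w : V → V → ℝ} {lam : ℝ} {k : ℕ} (hk : 0 < k) (hnonneg : ∀ u v, 0 ≤ w u v)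
    (hmin : ∀ P : Finpartition (univ : Finset V), P.parts.card = k → lam ≤ kCutWeight w P)
    {f : V → α} (hf : k ≤ (univ.image f).card) : lam ≤ labelCutWeight w f := by
  have : Nonempty (Fin k) := ⟨⟨0, hk⟩⟩
  obtain ⟨e⟩ : Nonempty (Fin k ↪ (univ.image f : Finset α)) :=
    Function.Embedding.nonempty_of_card_le (by simpa using hf)
  have he : Function.Injective fun i => (e i : α) := Subtype.val_injective.comp e.injective
  refine (le_labelCutWeight_of_surjective hmin
    (g := Function.invFun (fun i => (e i : α)) ∘ f) fun i => ?_).trans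
    (labelCutWeight_comp_le hnonneg f _)
  obtain ⟨v, -, hv⟩ := mem_image.1 (e i).2
  exact ⟨v, by simpa [hv] using Function.leftInverse_invFun he i⟩

theorem cutW_eq_labelCutWeight {V : Type*} [Fintype V] [DecidableEq V] {w : V → V → ℝ}
    (hsymm : ∀ u v, w u v = w v u) (S : Finset V) :
    cutW w S = labelCutWeight w fun v => decide (v ∈ S) := by
  have h₁ : cutW w S = ∑ u, ∑ v, if u ∈ S ∧ v ∉ S then w u v else 0 := by
    simp only [cutW, ← mem_compl, ite_and, sum_ite_irrel, sum_const_zero, sum_ite_mem, univ_inter]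
  have h₂ : cutW w S = ∑ u, ∑ v, if v ∈ S ∧ u ∉ S then w u v else 0 := by
    rw [h₁, sum_comm]
    simp only [hsymm]
  have h₃ : cutW w S + cutW w S =
      ∑ u, ∑ v, if decide (u ∈ S) = decide (v ∈ S) then (0 : ℝ) else w u v := by
    nth_rw 1 [h₁]
    rw [h₂]
    simp only [← sum_add_distrib]
    refine sum_congr rfl fun u _ => sum_congr rfl fun v _ => ?_
    by_cases hu : u ∈ S <;> by_cases hv : v ∈ S <;> simp [hu, hv]
  unfold labelCutWeight
  linarith

/-- The position of a vertex in the Venn diagram of the sets `F i`. -/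
def vennLabel {V : Type*} [DecidableEq V] {t : ℕ} (F : Fin t → Finset V) (v : V) :
    Fin t → Bool :=
  fun i => decide (v ∈ F i)

theorem vennCard_eq_card_image {V : Type*} [Fintype V] [DecidableEq V] {t : ℕ}
    (F : Fin t → Finset V) : vennCard F = (univ.image (vennLabel F)).card := by
  unfold vennCard
  congr 1
  ext g
  simp only [mem_filter, mem_univ, true_and, mem_image, Finset.Nonempty, funext_iff, vennLabel]
  refine exists_congr fun v => forall_congr' fun i => ?_
  by_cases h : v ∈ F i <;> cases g i <;> simp [h]

theorem labelCutWeight_vennLabel_le {V : Type*} [Fintype V] [DecidableEq V] {w : V → V → ℝ}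
    (hsymm : ∀ u v, w u v = w v u) (hnonneg : ∀ u v, 0 ≤ w u v) {t : ℕ}
    (F : Fin t → Finset V) : labelCutWeight w (vennLabel F) ≤ ∑ i, cutW w (F i) := by
  simp only [cutW_eq_labelCutWeight hsymm, labelCutWeight]
  rw [← mul_sum]
  conv_rhs => rw [sum_comm, sum_congr rfl fun u _ => sum_comm]
  gcongr with u _ v _
  have h0 : ∀ i ∈ univ, 0 ≤ if decide (u ∈ F i) = decide (v ∈ F i) then (0 : ℝ) else w u v :=
    fun i _ => by split_ifs <;> simp [hnonneg]
  split_ifs with h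
  · exact sum_nonneg h0
  · obtain ⟨i, hi⟩ := Function.ne_iff.1 h
    refine le_trans ?_ (single_le_sum h0 (mem_univ i))
    rw [if_neg (by exact hi)]

/-- If a two-valued labelling refines `f` so as to create two additional classes, then two
distinct classes of `f` are split by it. -/
theorem exists_ne_split {V α : Type*} [Fintype V] [DecidableEq α] (f : V → α) (b : V → Bool)
    (h : (univ.image f).card + 2 ≤ (univ.image fun v => (f v, b v)).card) :
    ∃ a a', a ≠ a' ∧ ∀ c, (c = a ∨ c = a') → ∀ β, ∃ v, f v = c ∧ b v = β := by
  let I := univ.image fun v => (f v, b v)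
  let S := (univ.image f).filter fun c => ∀ β, (c, β) ∈ I
  have hS : 1 < S.card := by
    have hle : I.card ≤ (univ.image f).card + S.card := by
      have h₁ : (I.image Prod.fst) = univ.image f := by simp [I, image_image, Function.comp_def]
      rw [card_eq_sum_card_image Prod.fst I, h₁, card_filter, card_eq_sum_ones, ← sum_add_distrib]
      refine sum_le_sum fun c _ => ?_
      have h₂ : I.filter (fun p => p.1 = c) ⊆ {(c, true), (c, false)} := by
        rintro ⟨x, β⟩ hx
        obtain rfl := (mem_filter.1 hx).2
        cases β <;> simp
      split_ifs with hc
      · exact (card_le_card h₂).trans card_le_two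
      · push Not at hc
        obtain ⟨β, hβ⟩ := hc
        rw [add_zero, card_le_one]
        rintro ⟨x, β₁⟩ hx ⟨y, β₂⟩ hy
        rw [mem_filter] at hx hy
        obtain ⟨hx, rfl⟩ := hx
        obtain ⟨hy, hyx⟩ := hy
        change y = x at hyx
        subst hyx
        cases β <;> cases β₁ <;> cases β₂ <;> simp_all
    have : I.card = (univ.image fun v => (f v, b v)).card := rfl
    omega
  obtain ⟨a, ha, a', ha', hne⟩ := one_lt_card.1 hS
  refine ⟨a, a', hne, fun c hc β => ?_⟩
  have hcS : c ∈ S := by rcases hc with rfl | rfl <;> assumption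
  simpa [I] using (mem_filter.1 hcS).2 β

/-- Splitting a single class of a labelling creates a new class. -/
theorem card_image_lt_card_image_split {V α : Type*} [Fintype V] [DecidableEq α]
    {f : V → α} {b : V → Bool} {a : α} (ha : ∀ β, ∃ v, f v = a ∧ b v = β) :
    (univ.image f).card + 1 ≤ (univ.image fun v => (f v, decide (f v = a) && b v)).card := by
  have hinj : Function.Injective fun x : α => (x, false) := fun x y h => (Prod.ext_iff.1 h).1
  rw [← card_image_of_injective (univ.image f) hinj,
    ← card_insert_of_notMem (a := (a, true)) (by simp)]
  refine card_le_card (insert_subset ?_ ?_)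
  · obtain ⟨v, hv, hb⟩ := ha true
    exact mem_image.2 ⟨v, mem_univ v, by simp [hv, hb]⟩
  · simp only [subset_iff, mem_image, mem_univ, true_and]
    rintro _ ⟨_, ⟨u, rfl⟩, rfl⟩
    by_cases hu : f u = a
    · obtain ⟨v, hv, hb⟩ := ha false
      exact ⟨v, by simp [hv, hb, hu]⟩
    · exact ⟨u, by simp [hu]⟩

theorem labelCutWeight_split_add_le {V α : Type*} [Fintype V] [DecidableEq α]
    {w : V → V → ℝ} (hnonneg : ∀ u v, 0 ≤ w u v) (f : V → α) (b : V → Bool) {a a' : α}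
    (hne : a ≠ a') :
    labelCutWeight w (fun v => (f v, decide (f v = a) && b v)) +
        labelCutWeight w (fun v => (f v, decide (f v = a') && b v)) ≤
      2 * labelCutWeight w f + labelCutWeight w b := by
  have hpt : ∀ u v,
      ((if (f u, decide (f u = a) && b u) = (f v, decide (f v = a) && b v) then 0 else w u v) +
        if (f u, decide (f u = a') && b u) = (f v, decide (f v = a') && b v) then 0 else w u v) ≤
      2 * (if f u = f v then 0 else w u v) + if b u = b v then 0 else w u v := by
    intro u v
    have h0 := hnonneg u v
    by_cases huv : f u = f v
    · by_cases h₁ : f v = a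
      · simp [huv, h₁, hne]
      · by_cases h₂ : f v = a'
        · simp [huv, h₂, hne.symm]
        · simp only [huv, h₁, h₂]
          split_ifs <;> simp_all
    · simp only [huv, Prod.mk.injEq, false_and, if_false]
      split_ifs <;> linarith
  have hsum := sum_le_sum fun u (_ : u ∈ univ) => sum_le_sum fun v (_ : v ∈ univ) => hpt u v
  simp only [sum_add_distrib, ← mul_sum] at hsum
  unfold labelCutWeight
  linarith

/-- Let `k ≥ 3`, `r = ⌈k/2⌉`, and let `T_1, …, T_r` be shores of medium cuts.  Then
`|Venn(T_1, …, T_{r−1})| < 2(r−1)` or `|Venn(T_1, …, T_r)| < 2r`. -/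
theorem venn_of_medium_cuts (k r : ℕ) (hk : 3 ≤ k) (hr : r = (k + 1) / 2)
    (V : Type) [Fintype V] [DecidableEq V] (w : V → V → ℝ) (lam : ℝ)
    (hn : k ≤ Fintype.card V)
    (hsymm : ∀ u v, w u v = w v u)
    (hnonneg : ∀ u v, 0 ≤ w u v)
    (hdiag : ∀ v, w v v = 0)
    (hex : ∃ P : Finpartition (univ : Finset V), P.parts.card = k ∧ kCutWeight w P = lam)
    (hmin : ∀ P : Finpartition (univ : Finset V), P.parts.card = k → lam ≤ kCutWeight w P)
    (T : Fin r → Finset V)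
    (hT : ∀ i, (T i).Nonempty ∧ (T i)ᶜ.Nonempty ∧
      lam / ((k : ℝ) - 1) ≤ cutW w (T i) ∧ cutW w (T i) < 2 * lam / k) :
    vennCard (fun i : Fin (r - 1) => T (Fin.castLE (Nat.sub_le r 1) i)) < 2 * (r - 1) ∨
      vennCard T < 2 * r := by
  by_contra! hcon
  obtain ⟨h₁, h₂⟩ := hcon
  obtain ⟨s, rfl⟩ : ∃ s, r = s + 1 := ⟨r - 1, by omega⟩
  change 2 * s ≤ vennCard (fun i : Fin s => T i.castSucc) at h₁
  set F : Fin s → Finset V := fun i => T i.castSucc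
  rw [vennCard_eq_card_image] at h₁ h₂
  have hk0 : (0 : ℝ) < k := by exact_mod_cast (by omega : 0 < k)
  have hT' : ∀ i, cutW w (T i) < 2 * lam / k := fun i => (hT i).2.2.2
  have hlast := hT' (Fin.last s)
  have hs : 0 < s := by omega
  have hFsum : ∑ i, cutW w (F i) < s * (2 * lam / k) := by
    have : (univ : Finset (Fin s)).Nonempty := ⟨⟨0, hs⟩, mem_univ _⟩
    simpa using sum_lt_sum_of_nonempty this fun i _ => hT' i.castSucc
  have hFle := labelCutWeight_vennLabel_le hsymm hnonneg F
  have hcutpos : 0 ≤ cutW w (T (Fin.last s)) :=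
    sum_nonneg fun u _ => sum_nonneg fun v _ => hnonneg u v
  rcases Nat.even_or_odd' k with ⟨m, hm | hm⟩
  · have hle := le_labelCutWeight (by omega) hnonneg hmin (f := vennLabel T) (by omega)
    have hTle := labelCutWeight_vennLabel_le hsymm hnonneg T
    rw [Fin.sum_univ_castSucc] at hTle
    have hks : (k : ℝ) = 2 * (s + 1) := by exact_mod_cast (by omega : k = 2 * (s + 1))
    have : s * (2 * lam / k) + 2 * lam / k = lam := by
      field_simp
      rw [hks]
      ring
    linarith
  · have hks : (k : ℝ) = 2 * s + 1 := by exact_mod_cast (by omega : k = 2 * s + 1)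
    have hval : s * (2 * lam / k) + lam / k = lam := by
      field_simp
      rw [hks]
      ring
    have hhalf : 2 * lam / k = 2 * (lam / k) := by ring
    by_cases hcard : k ≤ (univ.image (vennLabel F)).card
    · have := le_labelCutWeight (by omega) hnonneg hmin hcard
      linarith
    · let b : V → Bool := fun v => decide (v ∈ T (Fin.last s))
      have himage : (univ.image (vennLabel T)).card ≤
          (univ.image fun v => (vennLabel F v, b v)).card := by
        have : univ.image (vennLabel T) = (univ.image fun v => (vennLabel F v, b v)).image
            fun p => Fin.snoc (α := fun _ => Bool) p.1 p.2 := by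
          rw [image_image]
          congr 1
          funext v i
          refine Fin.lastCases ?_ (fun j => ?_) i <;> simp [vennLabel, F, b]
        rw [this]
        exact card_image_le
      obtain ⟨a, a', hne, hsplit⟩ := exists_ne_split (vennLabel F) b (by omega)
      have hle : ∀ c, (c = a ∨ c = a') → lam ≤ labelCutWeight w fun v =>
          (vennLabel F v, decide (vennLabel F v = c) && b v) := fun c hc =>
        le_labelCutWeight (by omega) hnonneg hmin
          (le_trans (by omega) (card_image_lt_card_image_split (hsplit c hc)))
      have hsum := labelCutWeight_split_add_le hnonneg (vennLabel F) b hne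
      have hb : labelCutWeight w b = cutW w (T (Fin.last s)) :=
        (cutW_eq_labelCutWeight hsymm _).symm
      linarith [hle a (Or.inl rfl), hle a' (Or.inr rfl)]
end

section
/- Let k ≥ 3 be an integer and let G be a weighted multigraph on a vertex set V with |V| = n ≥ k. Then there do not exist sets S_1, …, S_k ⊆ V and a set C such that: S_i ∩ S_j = C for all i ≠ j; C is nonempty and C ⊊ S_i ⊊ V for every i; every S_i is (the shore of) a medium cut, i.e., λ_k/(k−1) ≤ ∂S_i < 2λ_k/k; and ∂C ≥ λ_k/(k−1). (In other words, no k-sunflower of medium-cut shores with nonempty petals can have a core C of cut weight at least λ_k/(k−1).) -/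
open Finset

lemma cutW_eq_sum_ite {V : Type*} [Fintype V] [DecidableEq V] (w : V → V → ℝ) (S : Finset V) :
    cutW w S = ∑ u, ∑ v, if u ∈ S ∧ v ∉ S then w u v else 0 := by
  have (u : V) : ∑ v, (if u ∈ S ∧ v ∉ S then w u v else 0) =
      if u ∈ S then ∑ v ∈ Sᶜ, w u v else 0 := by
    split_ifs with h
    · simp only [h, true_and, ← mem_compl, Finset.sum_ite_mem, univ_inter]
    · simp [h]
  simp only [this, Finset.sum_ite_mem, univ_inter, cutW]

/-- Disjoint nonempty sets not covering `V`, together with the complement of their union,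
form a cut of weight at most the sum of their cut weights. -/
lemma exists_finpartition_kCutWeight_le_sum_cutW {V ι : Type*} [Fintype V] [DecidableEq V]
    (w : V → V → ℝ) (hsymm : ∀ u v, w u v = w v u) (hnonneg : ∀ u v, 0 ≤ w u v)
    (s : Finset ι) (A : ι → Finset V) (hne : ∀ i ∈ s, (A i).Nonempty)
    (hdisj : (s : Set ι).PairwiseDisjoint A) (hcover : s.biUnion A ≠ univ) :
    ∃ P : Finpartition (univ : Finset V), P.parts.card = s.card + 1 ∧
      kCutWeight w P ≤ ∑ i ∈ s, cutW w (A i) := by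
  classical
  have hinj : Set.InjOn A s := by
    intro i hi j hj hij
    by_contra hne'
    have := hdisj hi hj hne'
    rw [Function.onFun, ← hij, disjoint_self] at this
    exact (hne i hi).ne_empty this
  let Q : Finpartition (s.biUnion A) :=
    { parts := s.image A
      supIndep := by
        rw [Finset.supIndep_iff_pairwiseDisjoint]
        rintro _ hx _ hy hxy
        simp only [coe_image, Set.mem_image, mem_coe] at hx hy
        obtain ⟨i, hi, rfl⟩ := hx
        obtain ⟨j, hj, rfl⟩ := hy
        exact hdisj hi hj fun h => hxy (h ▸ rfl)
      sup_parts := by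
        rw [Finset.sup_image, Function.id_comp, Finset.sup_eq_biUnion]
      bot_notMem := by
        intro h
        obtain ⟨i, hi, h⟩ := mem_image.1 h
        exact (hne i hi).ne_empty h }
  have hb : (s.biUnion A)ᶜ ≠ ⊥ := by
    simpa [Finset.compl_eq_empty_iff] using hcover
  let P : Finpartition (univ : Finset V) :=
    Q.extend hb disjoint_compl_right (sup_compl_eq_top (x := s.biUnion A))
  have hparts : P.parts = insert (s.biUnion A)ᶜ (s.image A) := rfl
  refine ⟨P, ?_, ?_⟩
  · rw [Finpartition.card_extend, Finset.card_image_of_injOn hinj]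
  have hpt : ∀ u v, (if ∃ p ∈ P.parts, u ∈ p ∧ v ∈ p then (0 : ℝ) else w u v) ≤
      ∑ i ∈ s, ((if u ∈ A i ∧ v ∉ A i then w u v else 0) +
        (if v ∈ A i ∧ u ∉ A i then w v u else 0)) := by
    intro u v
    have hterm : ∀ i ∈ s, 0 ≤ (if u ∈ A i ∧ v ∉ A i then w u v else 0) +
        (if v ∈ A i ∧ u ∉ A i then w v u else 0) := by
      intro i _
      have := hnonneg u v
      have := hnonneg v u
      positivity
    split_ifs with h
    · exact Finset.sum_nonneg hterm
    · obtain ⟨i, hi, hiu⟩ : ∃ i ∈ s, (u ∈ A i ∧ v ∉ A i) ∨ (v ∈ A i ∧ u ∉ A i) := by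
        by_contra! hcon
        refine h ?_
        by_cases hu : ∃ i ∈ s, u ∈ A i
        · obtain ⟨i, hi, hui⟩ := hu
          refine ⟨A i, ?_, hui, by_contra fun hv => hv ((hcon i hi).1 hui)⟩
          rw [hparts]
          exact mem_insert_of_mem (mem_image_of_mem _ hi)
        · push Not at hu
          refine ⟨_, by rw [hparts]; exact mem_insert_self _ _, ?_, ?_⟩
          · simpa using hu
          · simp only [mem_compl, mem_biUnion, not_exists, not_and]
            exact fun i hi hv => hu i hi ((hcon i hi).2 hv)
      refine le_trans ?_ (Finset.single_le_sum hterm hi)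
      rcases hiu with h' | h'
      · simp [h'.1, h'.2]
      · simp [h'.1, h'.2, hsymm u v]
  have hswap : ∀ i, ∑ u, ∑ v, (if v ∈ A i ∧ u ∉ A i then w v u else 0) = cutW w (A i) := by
    intro i
    rw [Finset.sum_comm, cutW_eq_sum_ite]
  calc kCutWeight w P
      ≤ (1 / 2) * ∑ u, ∑ v, ∑ i ∈ s, ((if u ∈ A i ∧ v ∉ A i then w u v else 0) +
        (if v ∈ A i ∧ u ∉ A i then w v u else 0)) := by
        unfold kCutWeight
        gcongr with u _ v _
        convert hpt u v
    _ = (1 / 2) * ∑ i ∈ s, ∑ u, ∑ v, ((if u ∈ A i ∧ v ∉ A i then w u v else 0) +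
        (if v ∈ A i ∧ u ∉ A i then w v u else 0)) := by
        congr 1
        rw [Finset.sum_comm (s := s)]
        exact Finset.sum_congr rfl fun u _ => Finset.sum_comm
    _ = ∑ i ∈ s, cutW w (A i) := by
        simp only [Finset.sum_add_distrib, hswap, ← cutW_eq_sum_ite]
        ring

lemma cutW_union {V : Type*} [Fintype V] [DecidableEq V] (w : V → V → ℝ)
    (hsymm : ∀ u v, w u v = w v u) {A C : Finset V} (h : Disjoint A C) :
    cutW w (A ∪ C) = cutW w A + cutW w C - 2 * ∑ u ∈ C, ∑ v ∈ A, w u v := by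
  have hA : Aᶜ = (A ∪ C)ᶜ ∪ C := by
    ext x
    have : x ∈ A → x ∉ C := fun hx => Finset.disjoint_left.1 h hx
    simp only [mem_compl, mem_union]
    tauto
  have hC : Cᶜ = (A ∪ C)ᶜ ∪ A := by
    ext x
    have : x ∈ A → x ∉ C := fun hx => Finset.disjoint_left.1 h hx
    simp only [mem_compl, mem_union]
    tauto
  have dA : Disjoint (A ∪ C)ᶜ A := disjoint_compl_left.mono_right subset_union_left
  have dC : Disjoint (A ∪ C)ᶜ C := disjoint_compl_left.mono_right subset_union_right
  have hcomm : ∑ u ∈ A, ∑ v ∈ C, w u v = ∑ u ∈ C, ∑ v ∈ A, w u v := by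
    rw [Finset.sum_comm]
    simp only [hsymm]
  have h₁ : cutW w A = ∑ u ∈ A, ∑ v ∈ (A ∪ C)ᶜ, w u v + ∑ u ∈ C, ∑ v ∈ A, w u v := by
    rw [cutW, hA, ← hcomm, ← Finset.sum_add_distrib]
    exact Finset.sum_congr rfl fun u _ => Finset.sum_union dC
  have h₂ : cutW w C = ∑ u ∈ C, ∑ v ∈ (A ∪ C)ᶜ, w u v + ∑ u ∈ C, ∑ v ∈ A, w u v := by
    rw [cutW, hC, ← Finset.sum_add_distrib]
    exact Finset.sum_congr rfl fun u _ => Finset.sum_union dA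
  have h₃ : cutW w (A ∪ C) = ∑ u ∈ A, ∑ v ∈ (A ∪ C)ᶜ, w u v + ∑ u ∈ C, ∑ v ∈ (A ∪ C)ᶜ, w u v :=
    Finset.sum_union h
  linarith

/-- The cut weights of the shores of a sunflower bound those of its petals and core. -/
lemma sum_cutW_add_le_sum_cutW_union {V ι : Type*} [Fintype V] [DecidableEq V] [Fintype ι]
    (w : V → V → ℝ) (hsymm : ∀ u v, w u v = w v u) (hnonneg : ∀ u v, 0 ≤ w u v)
    (A : ι → Finset V) (C : Finset V) (hAC : ∀ i, Disjoint (A i) C)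
    (hdisj : Pairwise (Function.onFun Disjoint A)) :
    ∑ i, cutW w (A i) + ((Fintype.card ι : ℝ) - 2) * cutW w C ≤ ∑ i, cutW w (A i ∪ C) := by
  have hle : ∑ i, ∑ u ∈ C, ∑ v ∈ A i, w u v ≤ cutW w C := by
    rw [Finset.sum_comm]
    refine Finset.sum_le_sum fun u _ => ?_
    rw [← Finset.sum_biUnion fun i _ j _ hij => hdisj hij]
    refine Finset.sum_le_sum_of_subset_of_nonneg ?_ fun v _ _ => hnonneg u v
    intro x hx
    obtain ⟨i, _, hi⟩ := mem_biUnion.1 hx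
    exact mem_compl.2 (Finset.disjoint_left.1 (hAC i) hi)
  have heq : ∑ i, cutW w (A i ∪ C) = ∑ i, cutW w (A i) + (Fintype.card ι : ℝ) * cutW w C -
      2 * ∑ i, ∑ u ∈ C, ∑ v ∈ A i, w u v := by
    simp only [fun i => cutW_union w hsymm (hAC i), Finset.sum_sub_distrib,
      Finset.sum_add_distrib, Finset.mul_sum, Finset.sum_const, card_univ, nsmul_eq_mul]
  linarith

/-- No `k`-sunflower of medium-cut shores with nonempty petals can have a core `C` of
cut weight at least `λ_k/(k−1)`. -/
theorem no_medium_cut_sunflower_with_heavy_core (k : ℕ) (hk : 3 ≤ k)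
    (V : Type) [Fintype V] [DecidableEq V] (w : V → V → ℝ) (lam : ℝ)
    (hn : k ≤ Fintype.card V)
    (hsymm : ∀ u v, w u v = w v u)
    (hnonneg : ∀ u v, 0 ≤ w u v)
    (hdiag : ∀ v, w v v = 0)
    (hex : ∃ P : Finpartition (univ : Finset V), P.parts.card = k ∧ kCutWeight w P = lam)
    (hmin : ∀ P : Finpartition (univ : Finset V), P.parts.card = k → lam ≤ kCutWeight w P) :
    ¬ ∃ (S : Fin k → Finset V) (C : Finset V),
        (∀ i j, i ≠ j → S i ∩ S j = C) ∧
        C.Nonempty ∧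
        (∀ i, C ⊂ S i) ∧
        (∀ i, S i ≠ univ) ∧
        (∀ i, lam / ((k : ℝ) - 1) ≤ cutW w (S i) ∧ cutW w (S i) < 2 * lam / k) ∧
        lam / ((k : ℝ) - 1) ≤ cutW w C := by
  rintro ⟨S, C, hS, ⟨c, hc⟩, hCS, -, hmed, hcore⟩
  set A : Fin k → Finset V := fun i => S i \ C with hA
  have hAC : ∀ i, Disjoint (A i) C := fun i => sdiff_disjoint
  have hAS : ∀ i, A i ∪ C = S i := fun i => sdiff_union_of_subset (hCS i).1
  have hdisj : Pairwise (Function.onFun Disjoint A) := by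
    intro i j hij
    refine Finset.disjoint_left.2 fun x hi hj => ?_
    simp only [hA, mem_sdiff] at hi hj
    exact hi.2 (hS i j hij ▸ mem_inter.2 ⟨hi.1, hj.1⟩)
  have hne : ∀ i, (A i).Nonempty := fun i => sdiff_nonempty.2 (hCS i).2
  have hcut : ∀ j, lam ≤ ∑ i, cutW w (A i) - cutW w (A j) := by
    intro j
    have hcover : (univ.erase j).biUnion A ≠ univ := by
      intro h
      obtain ⟨i, _, hi⟩ := mem_biUnion.1 (h ▸ mem_univ c)
      exact Finset.disjoint_left.1 (hAC i) hi hc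
    obtain ⟨P, hP, hle⟩ := exists_finpartition_kCutWeight_le_sum_cutW w hsymm hnonneg
      (univ.erase j) A (fun i _ => hne i) (fun a _ b _ hab => hdisj hab) hcover
    have hcard : P.parts.card = k := by
      rw [hP, card_erase_of_mem (mem_univ j), card_univ, Fintype.card_fin]
      omega
    have := Finset.sum_erase_add univ (fun i => cutW w (A i)) (mem_univ j)
    linarith [hmin P hcard]
  have hpetals : (k : ℝ) * lam ≤ ((k : ℝ) - 1) * ∑ i, cutW w (A i) := by
    have := Finset.sum_le_sum fun j (_ : j ∈ (univ : Finset (Fin k))) => hcut j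
    simp only [Finset.sum_sub_distrib, sum_const, card_univ, Fintype.card_fin,
      nsmul_eq_mul] at this
    linarith
  have hsun := sum_cutW_add_le_sum_cutW_union w hsymm hnonneg A C hAC hdisj
  simp only [hAS, Fintype.card_fin] at hsun
  have hk' : (3 : ℝ) ≤ k := by exact_mod_cast hk
  have hshores : ∑ i, cutW w (S i) < 2 * lam := by
    have : Nonempty (Fin k) := ⟨⟨0, by omega⟩⟩
    calc ∑ i, cutW w (S i) < ∑ _i : Fin k, 2 * lam / k :=
          Finset.sum_lt_sum_of_nonempty univ_nonempty fun i _ => (hmed i).2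
      _ = 2 * lam := by
          rw [sum_const, card_univ, Fintype.card_fin, nsmul_eq_mul]
          field_simp
  have hk1 : (0 : ℝ) < k - 1 := by linarith
  rw [div_le_iff₀ hk1] at hcore
  nlinarith [mul_le_mul_of_nonneg_left hcore (by linarith : (0 : ℝ) ≤ k - 2),
    mul_le_mul_of_nonneg_left hsun hk1.le, mul_lt_mul_of_pos_left hshores hk1]
end

section
/- Let k ≥ 3 be an integer, let G be a weighted multigraph on a vertex set V with |V| = n, let ε ∈ (0, 1/k) be real, and let j : V → V → ℝ be a symmetric nonnegative function with j(v,v) = 0 and j(u,v) ≤ w(u,v) for all u,v (modeling an edge subset J). Let α ≥ 0 be a real with (1/2)∑_{u,v} j(u,v) ≤ α·λ_k, and set λ̄_k = λ_k/k and β = k + 2αk/ε. Call a subset S with ∅ ≠ S ⊊ V a good cut if it is a medium cut (λ_k/(k−1) ≤ ∂S < 2λ_k/k) and moreover ∂S − ∂_j S ≥ (1−ε)·(k/(k−1))·λ̄_k, where ∂_j S = ∑_{u∈S, v∉S} j(u,v). Let s be the number of good cuts (counted as unordered pairs {S, V∖S}). If n ≥ β, then the total edge weight m satisfies m ≥ s·(k/(k−1))·λ̄_k/2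 + (n − s − β)·λ̄_k. -/
open Finset

section DegreeLemmas

variable {V : Type*} [Fintype V] [DecidableEq V]

theorem cutW_singleton {w : V → V → ℝ} (hdiag : ∀ v, w v v = 0) (v : V) :
    cutW w {v} = ∑ u, w v u := by
  unfold cutW
  rw [sum_singleton, ← sum_add_sum_compl {v} (fun u => w v u), sum_singleton, hdiag, zero_add]

theorem kCutWeight_nonneg {w : V → V → ℝ} (hnonneg : ∀ u v, 0 ≤ w u v)
    (P : Finpartition (univ : Finset V)) : 0 ≤ kCutWeight w P := by
  refine mul_nonneg (by norm_num) (sum_nonneg fun u _ => sum_nonneg fun v _ => ?_)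
  split_ifs
  · exact le_rfl
  · exact hnonneg u v

/-- Splitting off the vertices of `T` as singletons costs at most the sum of their degrees. -/
theorem exists_kCutWeight_le_sum_degree {w : V → V → ℝ} (hsymm : ∀ u v, w u v = w v u)
    (hnonneg : ∀ u v, 0 ≤ w u v) (T : Finset V) (hT : Tᶜ.Nonempty) :
    ∃ P : Finpartition (univ : Finset V), P.parts.card = T.card + 1 ∧
      kCutWeight w P ≤ ∑ v ∈ T, ∑ u, w v u := by
  have hne : Tᶜ ≠ ⊥ := hT.ne_empty
  have hdis : Disjoint T Tᶜ := disjoint_compl_right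
  have hsup : T ⊔ Tᶜ = univ := sup_compl_eq_top
  refine ⟨(⊥ : Finpartition T).extend hne hdis hsup, ?_, ?_⟩
  · rw [Finpartition.card_extend, Finpartition.card_bot]
  have hle : ∀ u v, (if ∃ p ∈ ((⊥ : Finpartition T).extend hne hdis hsup).parts,
      u ∈ p ∧ v ∈ p then (0 : ℝ) else w u v) ≤
      (if u ∈ T then w u v else 0) + (if v ∈ T then w u v else 0) := by
    intro u v
    have h0 := hnonneg u v
    by_cases hu : u ∈ T
    · split_ifs <;> linarith
    by_cases hv : v ∈ T
    · split_ifs <;> linarith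
    rw [if_pos ⟨Tᶜ, mem_insert_self _ _, mem_compl.2 hu, mem_compl.2 hv⟩]
    simp [hu, hv]
  have hrow : ∑ u, ∑ v, (if u ∈ T then w u v else 0) = ∑ v ∈ T, ∑ u, w v u := by
    have hite : ∀ u, ∑ v, (if u ∈ T then w u v else 0) = if u ∈ T then ∑ v, w u v else 0 := by
      intro u
      split_ifs <;> simp
    simp only [hite, sum_ite_mem, univ_inter]
  have hcol : ∑ u, ∑ v, (if v ∈ T then w u v else 0) = ∑ v ∈ T, ∑ u, w v u := by
    rw [sum_comm, ← hrow]
    simp only [hsymm]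
  have hsum := sum_le_sum fun u (_ : u ∈ univ) => sum_le_sum fun v (_ : v ∈ univ) => hle u v
  simp only [sum_add_distrib] at hsum
  unfold kCutWeight
  linarith

/-- Fewer than `k - 1` vertices have degree below `lam / (k - 1)`. -/
theorem card_degree_lt_le {w : V → V → ℝ} {k : ℕ} {lam : ℝ} (hk : 2 ≤ k)
    (hn : k ≤ Fintype.card V) (hsymm : ∀ u v, w u v = w v u) (hnonneg : ∀ u v, 0 ≤ w u v)
    (hmin : ∀ P : Finpartition (univ : Finset V), P.parts.card = k → lam ≤ kCutWeight w P) :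
    #{v | ∑ u, w v u < lam / ((k : ℝ) - 1)} ≤ k - 2 := by
  by_contra! h
  obtain ⟨T, hTsub, hTcard⟩ := exists_subset_card_eq (Nat.succ_le_of_lt h)
  have hT : Tᶜ.Nonempty := by
    rw [← card_pos, card_compl]
    omega
  obtain ⟨P, hPcard, hP⟩ := exists_kCutWeight_le_sum_degree hsymm hnonneg T hT
  have hlt : ∑ v ∈ T, ∑ u, w v u < ∑ _v ∈ T, lam / ((k : ℝ) - 1) :=
    sum_lt_sum_of_nonempty (card_pos.1 (by omega)) fun v hv => (mem_filter.1 (hTsub hv)).2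
  have hk' : (2 : ℝ) ≤ k := by exact_mod_cast hk
  rw [sum_const, nsmul_eq_mul, show #T = k - 1 by omega, Nat.cast_sub (by omega), Nat.cast_one,
    mul_div_cancel₀ _ (by linarith)] at hlt
  linarith [hmin P (by omega)]

/-- In a vertex set with at least three elements, the 2-cuts `{{v}, {v}ᶜ}` are distinct. -/
theorem singleton_cut_injective (hn : 3 ≤ Fintype.card V) :
    Function.Injective fun v : V => ({{v}, {v}ᶜ} : Finset (Finset V)) := by
  intro u v huv
  have hmem : ({u} : Finset V) ∈ ({{v}, {v}ᶜ} : Finset (Finset V)) := by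
    rw [← show ({{u}, {u}ᶜ} : Finset (Finset V)) = {{v}, {v}ᶜ} from huv]
    exact mem_insert_self _ _
  rcases mem_insert.1 hmem with h | h
  · exact singleton_injective h
  · have hcard := congrArg card (mem_singleton.1 h)
    rw [card_singleton, card_compl, card_singleton] at hcard
    omega

end DegreeLemmas

/-- If `G` has `s` good cuts and `n ≥ β = k + 2αk/ε`, then the total edge weight `m`
satisfies `m ≥ s·(k/(k−1))·λ̄_k/2 + (n − s − β)·λ̄_k`, where `λ̄_k = λ_k/k`.  A good cut
is a medium cut `S` with `∂S − ∂_j S ≥ (1−ε)·(k/(k−1))·λ̄_k`, where `j` models an edge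
subset `J` of total weight at most `α·λ_k`. -/
theorem edge_count_with_good_cuts (k : ℕ) (hk : 3 ≤ k)
    (V : Type) [Fintype V] [DecidableEq V] (w : V → V → ℝ) (lam : ℝ)
    (ε α : ℝ) (j : V → V → ℝ)
    (hn : k ≤ Fintype.card V)
    (hsymm : ∀ u v, w u v = w v u)
    (hnonneg : ∀ u v, 0 ≤ w u v)
    (hdiag : ∀ v, w v v = 0)
    (hex : ∃ P : Finpartition (univ : Finset V), P.parts.card = k ∧ kCutWeight w P = lam)
    (hmin : ∀ P : Finpartition (univ : Finset V), P.parts.card = k → lam ≤ kCutWeight w P)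
    (hε0 : 0 < ε) (hεk : ε < 1 / k)
    (hjsymm : ∀ u v, j u v = j v u)
    (hjnonneg : ∀ u v, 0 ≤ j u v)
    (hjdiag : ∀ v, j v v = 0)
    (hjw : ∀ u v, j u v ≤ w u v)
    (hα : 0 ≤ α)
    (hJ : (1 / 2) * ∑ u, ∑ v, j u v ≤ α * lam)
    (s : ℕ)
    (hs : s = {p : Finset (Finset V) | ∃ S : Finset V, p = {S, Sᶜ} ∧
        S.Nonempty ∧ Sᶜ.Nonempty ∧
        lam / ((k : ℝ) - 1) ≤ cutW w S ∧ cutW w S < 2 * lam / k ∧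
        (1 - ε) * ((k : ℝ) / ((k : ℝ) - 1)) * (lam / k) ≤ cutW w S - cutW j S}.ncard)
    (hnβ : (k : ℝ) + 2 * α * k / ε ≤ (Fintype.card V : ℝ)) :
    (s : ℝ) * ((k : ℝ) / ((k : ℝ) - 1)) * (lam / k) / 2 +
        ((Fintype.card V : ℝ) - s - ((k : ℝ) + 2 * α * k / ε)) * (lam / k) ≤
      (1 / 2) * ∑ u, ∑ v, w u v := by
  have hk3 : (3 : ℝ) ≤ k := by exact_mod_cast hk
  have hk0 : (0 : ℝ) < k := by linarith
  have hk1 : (0 : ℝ) < (k : ℝ) - 1 := by linarith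
  have hlam : 0 ≤ lam := by
    obtain ⟨P, -, rfl⟩ := hex
    exact kCutWeight_nonneg hnonneg P
  have hdeg0 : ∀ v, 0 ≤ ∑ u, w v u := fun v => sum_nonneg fun u _ => hnonneg v u
  have hjdeg0 : ∀ v, 0 ≤ ∑ u, j v u := fun v => sum_nonneg fun u _ => hjnonneg v u
  have hcoef : lam / k ≤ lam / ((k : ℝ) - 1) := by
    gcongr
    linarith
  have hcoef' : lam / ((k : ℝ) - 1) ≤ 2 * lam / k := by
    rw [div_le_div_iff₀ hk1 hk0]
    nlinarith
  have hcancel : (k : ℝ) / ((k : ℝ) - 1) * (lam / k) = lam / ((k : ℝ) - 1) := by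
    field_simp
  let low : Finset V := {v | ∑ u, w v u < lam / ((k : ℝ) - 1)}
  let good : Finset V := {v | lam / ((k : ℝ) - 1) ≤ ∑ u, w v u ∧ ∑ u, w v u < 2 * lam / k ∧
    (1 - ε) * (lam / ((k : ℝ) - 1)) ≤ ∑ u, w v u - ∑ u, j v u}
  have hlow : (#low : ℝ) ≤ k := by
    have := card_degree_lt_le (by omega : 2 ≤ k) hn hsymm hnonneg hmin
    exact Nat.cast_le.2 (this.trans (Nat.sub_le k 2))
  have hgood : (#good : ℝ) ≤ s := by
    rw [Nat.cast_le, hs, ← card_image_of_injective good (singleton_cut_injective (hk.trans hn)),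
      ← Set.ncard_coe_finset]
    refine Set.ncard_le_ncard ?_ (Set.toFinite _)
    intro p hp
    obtain ⟨v, hv, rfl⟩ := mem_image.1 (mem_coe.1 hp)
    obtain ⟨h1, h2, h3⟩ := (mem_filter.1 hv).2
    refine ⟨{v}, rfl, singleton_nonempty v, ?_, ?_⟩
    · rw [← card_pos, card_compl, card_singleton]
      omega
    · rw [cutW_singleton hdiag, cutW_singleton hjdiag, mul_assoc, hcancel]
      exact ⟨h1, h2, h3⟩
  have hpoint : ∀ v, 2 * lam / k ≤ ∑ u, w v u + (if v ∈ low then 2 * lam / k else 0) +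
      (if v ∈ good then 2 * lam / k - lam / ((k : ℝ) - 1) else 0) +
      2 / ε * ∑ u, j v u := by
    intro v
    have hd := hdeg0 v
    have hjd : 0 ≤ 2 / ε * ∑ u, j v u := mul_nonneg (by positivity) (hjdeg0 v)
    by_cases hl : v ∈ low
    · rw [if_pos hl]
      split_ifs <;> linarith
    have hmed : lam / ((k : ℝ) - 1) ≤ ∑ u, w v u := by
      by_contra! h
      exact hl (mem_filter.2 ⟨mem_univ v, h⟩)
    by_cases hg : v ∈ good
    · rw [if_neg hl, if_pos hg]
      linarith
    rw [if_neg hl, if_neg hg]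
    by_cases hbig : 2 * lam / k ≤ ∑ u, w v u
    · linarith
    have hbad : ε * (lam / k) ≤ ∑ u, j v u := by
      by_contra! h
      refine hg (mem_filter.2 ⟨mem_univ v, hmed, not_le.1 hbig, ?_⟩)
      nlinarith
    have hscale : 2 / ε * (ε * (lam / k)) ≤ 2 / ε * ∑ u, j v u := by gcongr
    have heq : 2 / ε * (ε * (lam / k)) = 2 * lam / k := by field_simp
    linarith
  have hsum := sum_le_sum fun v (_ : v ∈ univ) => hpoint v
  simp only [sum_add_distrib, sum_const, nsmul_eq_mul, sum_ite_mem, univ_inter, ← mul_sum,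
    card_univ] at hsum
  have hlow' : #low * (2 * lam / k) ≤ k * (2 * lam / k) := by gcongr
  have hgood' : #good * (2 * lam / k - lam / ((k : ℝ) - 1)) ≤
      s * (2 * lam / k - lam / ((k : ℝ) - 1)) := by
    gcongr
  have hJ' : 2 / ε * ∑ u, ∑ v, j u v ≤ 2 / ε * (2 * (α * lam)) := by
    gcongr
    linarith
  have hβ : 2 * α * k / ε * (lam / k) = 2 / ε * (α * lam) := by field_simp
  have hlam2 : 2 * lam / k = 2 * (lam / k) := by ring
  rw [mul_assoc (s : ℝ), hcancel]
  rw [hlam2] at hsum hlow' hgood'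
  linarith
end

section
/- Let δ be a real number with 0 < δ ≤ 1/2. Then for all real θ ∈ [0,1] and t ∈ [1,2]: δ + (2−t)·(1+δ)·(1 − θ^δ) − δ·θ^{1+δ}·e^{2(1−θ)(1+δ)/t} ≥ 0. -/
lemma rpow_le_exp_mul_sub_one {a x : ℝ} (ha : 0 ≤ a) (hx : 0 < x) :
    x ^ a ≤ Real.exp (a * (x - 1)) := by
  rw [Real.rpow_def_of_pos hx, mul_comm]
  gcongr
  exact Real.log_le_sub_one_of_pos hx

lemma mul_rpow_mul_exp_le {δ x : ℝ} (hδ0 : 0 < δ) (hδ : δ ≤ 1 / 2) (hx0 : 0 < x) (hx1 : x ≤ 1) :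
    (2 * (1 + δ) * x - 1) * (x ^ (1 + δ) * Real.exp (2 * (1 - x) * (1 + δ))) ≤ 1 + 2 * δ := by
  have hlin : 2 * (1 + δ) * x - 1 ≤ (1 + 2 * δ) * Real.exp ((1 + δ) * (x - 1)) := by
    have hz : (2 * (1 + δ) * x - 1) / (1 + 2 * δ) ≤ Real.exp ((1 + δ) * (x - 1)) := by
      refine le_trans ?_ (Real.add_one_le_exp _)
      rw [div_le_iff₀ (by linarith)]
      nlinarith [mul_nonneg (mul_nonneg (sub_nonneg.2 hx1) (by linarith : 0 ≤ 1 + δ))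
        (by linarith : 0 ≤ 1 - 2 * δ)]
    rw [div_le_iff₀ (by linarith)] at hz
    linarith
  have hpow := rpow_le_exp_mul_sub_one (by linarith : 0 ≤ 1 + δ) hx0
  calc (2 * (1 + δ) * x - 1) * (x ^ (1 + δ) * Real.exp (2 * (1 - x) * (1 + δ)))
      ≤ ((1 + 2 * δ) * Real.exp ((1 + δ) * (x - 1))) *
          (Real.exp ((1 + δ) * (x - 1)) * Real.exp (2 * (1 - x) * (1 + δ))) := by gcongr
    _ = (1 + 2 * δ) * Real.exp ((1 + δ) * (x - 1) + ((1 + δ) * (x - 1) +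
          2 * (1 - x) * (1 + δ))) := by rw [Real.exp_add, Real.exp_add]; ring
    _ = 1 + 2 * δ := by ring_nf; simp [add_comm]

lemma mul_exp_le_rpow_neg {δ θ : ℝ} (hδ0 : 0 < δ) (hδ : δ ≤ 1 / 2) (hθ0 : 0 < θ) (hθ1 : θ ≤ 1) :
    δ * θ * Real.exp (2 * (1 - θ) * (1 + δ)) ≤ (1 + 2 * δ) * θ ^ (-δ) - (1 + δ) := by
  have hderiv : ∀ x : ℝ, 0 < x → HasDerivAt
      (fun x : ℝ => (1 + 2 * δ) * x ^ (-δ) - (1 + δ) - δ * x * Real.exp (2 * (1 - x) * (1 + δ)))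
      (δ * ((2 * (1 + δ) * x - 1) * Real.exp (2 * (1 - x) * (1 + δ))
        - (1 + 2 * δ) * x ^ (-δ - 1))) x := by
    intro x hx
    have h1 := ((Real.hasDerivAt_rpow_const (p := -δ) (Or.inl hx.ne')).const_mul
      (1 + 2 * δ)).sub_const (1 + δ)
    have h2 := ((hasDerivAt_id x).const_mul δ).mul
      (((((hasDerivAt_id x).const_sub 1).const_mul 2).mul_const (1 + δ)).exp)
    refine (h1.sub h2).congr_deriv ?_
    simp only [id]
    ring
  have hanti : AntitoneOn
      (fun x : ℝ => (1 + 2 * δ) * x ^ (-δ) - (1 + δ) - δ * x * Real.exp (2 * (1 - x) * (1 + δ)))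
      (Set.Icc θ 1) := by
    refine antitoneOn_of_hasDerivWithinAt_nonpos (convex_Icc θ 1)
      (fun x hx => (hderiv x (hθ0.trans_le hx.1)).continuousAt.continuousWithinAt)
      (fun x hx => (hderiv x ?_).hasDerivWithinAt) (fun x hx => ?_)
    · rw [interior_Icc] at hx
      exact hθ0.trans hx.1
    · rw [interior_Icc] at hx
      have hx0 := hθ0.trans hx.1
      have hkey := mul_rpow_mul_exp_le hδ0 hδ hx0 hx.2.le
      refine mul_nonpos_of_nonneg_of_nonpos hδ0.le (sub_nonpos.2 ?_)
      rw [show -δ - 1 = -(1 + δ) by ring, Real.rpow_neg hx0.le, ← div_eq_mul_inv,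
        le_div_iff₀ (Real.rpow_pos_of_pos hx0 _)]
      linarith
  have h := hanti (Set.left_mem_Icc.2 hθ1) (Set.right_mem_Icc.2 hθ1) hθ1
  norm_num at h
  linarith

lemma exp_div_le_of_mem_Icc_one_two {c t : ℝ} (hc : 0 ≤ c) (ht1 : 1 ≤ t) (ht2 : t ≤ 2) :
    Real.exp (c / t) ≤ (2 - t) * Real.exp c + (t - 1) * Real.exp (c / 2) := by
  have hconv := convexOn_exp.2 (Set.mem_univ c) (Set.mem_univ (c / 2))
    (sub_nonneg.2 ht2) (sub_nonneg.2 ht1) (by ring)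
  simp only [smul_eq_mul] at hconv
  refine le_trans (Real.exp_le_exp.2 ?_) hconv
  rw [div_le_iff₀ (by linarith)]
  nlinarith [mul_nonneg hc (mul_nonneg (sub_nonneg.2 ht2) (sub_nonneg.2 ht1))]

/-- For `0 < δ ≤ 1/2`, `θ ∈ [0,1]` and `t ∈ [1,2]`:
`δ + (2−t)(1+δ)(1 − θ^δ) − δ·θ^{1+δ}·e^{2(1−θ)(1+δ)/t} ≥ 0`. -/
theorem key_inequality_F_nonneg (δ θ t : ℝ)
    (hδ0 : 0 < δ) (hδ : δ ≤ 1 / 2)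
    (hθ0 : 0 ≤ θ) (hθ1 : θ ≤ 1)
    (ht1 : 1 ≤ t) (ht2 : t ≤ 2) :
    0 ≤ δ + (2 - t) * (1 + δ) * (1 - θ ^ δ) -
      δ * θ ^ (1 + δ) * Real.exp (2 * (1 - θ) * (1 + δ) / t) := by
  rcases hθ0.eq_or_lt with rfl | hθ
  · rw [Real.zero_rpow hδ0.ne', Real.zero_rpow (by linarith)]
    have := mul_nonneg (sub_nonneg.2 ht2) (by linarith : 0 ≤ 1 + δ)
    linarith
  have hA : 0 < θ ^ δ := Real.rpow_pos_of_pos hθ _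
  have hB : 0 < θ ^ (1 + δ) := Real.rpow_pos_of_pos hθ _
  have hone : δ * θ ^ (1 + δ) * Real.exp (2 * (1 - θ) * (1 + δ)) ≤
      δ + (1 + δ) * (1 - θ ^ δ) := by
    have h := mul_le_mul_of_nonneg_left (mul_exp_le_rpow_neg hδ0 hδ hθ hθ1) hA.le
    have hinv : θ ^ δ * θ ^ (-δ) = 1 := by rw [← Real.rpow_add hθ]; simp
    rw [Real.rpow_add hθ, Real.rpow_one]
    linear_combination h + (1 + 2 * δ) * hinv
  have htwo : θ ^ (1 + δ) * Real.exp (2 * (1 - θ) * (1 + δ) / 2) ≤ 1 := by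
    calc θ ^ (1 + δ) * Real.exp (2 * (1 - θ) * (1 + δ) / 2)
        ≤ Real.exp ((1 + δ) * (θ - 1)) * Real.exp (2 * (1 - θ) * (1 + δ) / 2) := by
          gcongr
          exact rpow_le_exp_mul_sub_one (by linarith) hθ
      _ = 1 := by rw [← Real.exp_add]; ring_nf; simp
  have hc : 0 ≤ 2 * (1 - θ) * (1 + δ) :=
    mul_nonneg (by linarith) (by linarith)
  have hexp := mul_le_mul_of_nonneg_left (exp_div_le_of_mem_Icc_one_two hc ht1 ht2)
    (mul_pos hδ0 hB).le
  have h1 := mul_le_mul_of_nonneg_left hone (sub_nonneg.2 ht2)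
  have h2 := mul_le_mul_of_nonneg_left htwo (mul_nonneg hδ0.le (sub_nonneg.2 ht1))
  linear_combination hexp + h1 + h2
end

section
/- Let δ be a real number with 0 < δ ≤ 1/2. Then for all real θ ∈ [0,1]: δ + (1+δ)·(1 − θ^δ) ≥ δ·θ^{1+δ}·e^{2(1−θ)(1+δ)}. -/
/-- Bernoulli's inequality for negative exponents in `[-1, 0]`, cleared of denominators. -/
lemma le_rpow_mul_of_le_one {δ x : ℝ} (hδ0 : 0 ≤ δ) (hδ : δ ≤ 1) (hx : 0 < x) :
    x ≤ x ^ δ * (x + δ * (1 - x)) := by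
  have hb := rpow_one_add_le_one_add_mul_self (s := x⁻¹ - 1) (p := δ)
    (by linarith [inv_pos.2 hx]) hδ0 hδ
  rw [add_sub_cancel, Real.inv_rpow hx.le] at hb
  have hy : 0 < x ^ δ := Real.rpow_pos_of_pos hx δ
  have h := mul_le_mul_of_nonneg_left hb (mul_pos hx hy).le
  have e₁ : x * x ^ δ * (x ^ δ)⁻¹ = x := by field_simp
  have e₂ : x * x ^ δ * (1 + δ * (x⁻¹ - 1)) = x ^ δ * (x + δ * (1 - x)) := by field_simp
  rwa [e₁, e₂] at h

lemma two_mul_sub_one_mul_le_rpow {δ x : ℝ} (hδ0 : 0 < δ) (hδ : δ ≤ 1 / 2)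
    (hx : 0 < x) (hx1 : x ≤ 1) :
    (2 * x - 1) * (δ + (1 + δ) * (1 - x ^ δ)) ≤ δ * x ^ δ := by
  have hy : 0 < x ^ δ := Real.rpow_pos_of_pos hx δ
  have hy1 : x ^ δ ≤ 1 := Real.rpow_le_one hx.le hx1 hδ0.le
  rcases le_total (2 * x - 1) 0 with h | h
  · have hD : 0 ≤ δ + (1 + δ) * (1 - x ^ δ) := by nlinarith
    exact (mul_nonpos_of_nonpos_of_nonneg h hD).trans (by positivity)
  · have hb := le_rpow_mul_of_le_one hδ0.le (by linarith) hx
    have hc : 0 < x + δ * (1 - x) := by nlinarith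
    have hm : 0 ≤ δ + (2 * x - 1) * (1 + δ) := by nlinarith
    have hp : (2 * x - 1) * (1 + 2 * δ) * (x + δ * (1 - x)) ≤
        x * (δ + (2 * x - 1) * (1 + δ)) := by
      have h₁ : 0 ≤ δ * (1 - 2 * δ) * (1 - x) :=
        mul_nonneg (mul_nonneg hδ0.le (by linarith)) (by linarith)
      nlinarith [sq_nonneg (δ * (1 - x))]
    have hq := mul_le_mul_of_nonneg_right hb hm
    have : (2 * x - 1) * (1 + 2 * δ) ≤ x ^ δ * (δ + (2 * x - 1) * (1 + δ)) := by
      refine le_of_mul_le_mul_right ?_ hc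
      linarith
    linarith

lemma antitoneOn_log_sub_log {δ : ℝ} (hδ0 : 0 < δ) (hδ : δ ≤ 1 / 2) :
    AntitoneOn (fun x : ℝ => Real.log (δ + (1 + δ) * (1 - x ^ δ)) -
      (1 + δ) * (Real.log x + 2 * (1 - x))) (Set.Ioc 0 1) := by
  have hD : ∀ x ∈ Set.Ioc (0 : ℝ) 1, 0 < δ + (1 + δ) * (1 - x ^ δ) := fun x hx => by
    have := Real.rpow_le_one hx.1.le hx.2 hδ0.le
    nlinarith
  have hd : ∀ x ∈ Set.Ioc (0 : ℝ) 1, HasDerivAt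
      (fun x : ℝ => Real.log (δ + (1 + δ) * (1 - x ^ δ)) -
        (1 + δ) * (Real.log x + 2 * (1 - x)))
      (((1 + δ) * (-(δ * x ^ (δ - 1)))) / (δ + (1 + δ) * (1 - x ^ δ)) -
        (1 + δ) * (x⁻¹ + 2 * (-1))) x := fun x hx =>
    (((((Real.hasDerivAt_rpow_const (Or.inl hx.1.ne')).const_sub 1).const_mul
      (1 + δ)).const_add δ).log (hD x hx).ne').sub
      (((Real.hasDerivAt_log hx.1.ne').add
        (((hasDerivAt_id x).const_sub 1).const_mul 2)).const_mul (1 + δ))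
  refine antitoneOn_of_deriv_nonpos (convex_Ioc 0 1)
    (fun x hx => (hd x hx).continuousAt.continuousWithinAt)
    (fun x hx => (hd x (interior_subset hx)).differentiableAt.differentiableWithinAt)
    fun x hx => ?_
  have hx' := interior_subset hx
  have hx0 : 0 < x := hx'.1
  rw [(hd x hx').deriv, Real.rpow_sub_one hx0.ne']
  have hDx := hD x hx'
  have key := two_mul_sub_one_mul_le_rpow hδ0 hδ hx0 hx'.2
  have e : ((1 + δ) * (-(δ * (x ^ δ / x)))) / (δ + (1 + δ) * (1 - x ^ δ)) -
      (1 + δ) * (x⁻¹ + 2 * (-1)) =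
      (1 + δ) * ((2 * x - 1) * (δ + (1 + δ) * (1 - x ^ δ)) - δ * x ^ δ) /
        (x * (δ + (1 + δ) * (1 - x ^ δ))) := by
    generalize δ + (1 + δ) * (1 - x ^ δ) = D at hDx
    field_simp
    ring
  rw [e]
  exact div_nonpos_of_nonpos_of_nonneg
    (mul_nonpos_of_nonneg_of_nonpos (by linarith) (by linarith)) (by positivity)

/-- For `0 < δ ≤ 1/2` and `θ ∈ [0,1]`:
`δ + (1+δ)(1 − θ^δ) ≥ δ·θ^{1+δ}·e^{2(1−θ)(1+δ)}`. -/
theorem key_inequality_t_eq_one (δ θ : ℝ)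
    (hδ0 : 0 < δ) (hδ : δ ≤ 1 / 2)
    (hθ0 : 0 ≤ θ) (hθ1 : θ ≤ 1) :
    δ * θ ^ (1 + δ) * Real.exp (2 * (1 - θ) * (1 + δ)) ≤ δ + (1 + δ) * (1 - θ ^ δ) := by
  have hy1 : θ ^ δ ≤ 1 := Real.rpow_le_one hθ0 hθ1 hδ0.le
  have hD : 0 < δ + (1 + δ) * (1 - θ ^ δ) := by nlinarith
  rcases hθ0.eq_or_lt with rfl | hθ
  · rw [Real.zero_rpow (by linarith : 1 + δ ≠ 0), mul_zero, zero_mul]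
    exact hD.le
  · have h := antitoneOn_log_sub_log hδ0 hδ ⟨hθ, hθ1⟩ ⟨one_pos, le_rfl⟩ hθ1
    simp only [Real.one_rpow, sub_self, mul_zero, add_zero, Real.log_one, sub_zero] at h
    rw [← Real.log_le_log_iff (by positivity) hD, Real.log_mul (by positivity) (by positivity),
      Real.log_mul hδ0.ne' (by positivity), Real.log_rpow hθ, Real.log_exp]
    linarith
end

section
/- For every real θ with 0 < θ < 1, we have e^{−3(1−θ)} − 2θ² + θ > 0. -/
/-- For every real `θ` with `0 < θ < 1`, we have `e^{−3(1−θ)} − 2θ² + θ > 0`. -/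
theorem exp_neg_three_sub_quadratic_pos (θ : ℝ) (h0 : 0 < θ) (h1 : θ < 1) :
    0 < Real.exp (-3 * (1 - θ)) - 2 * θ ^ 2 + θ := by
  have hcube : θ ^ 3 ≤ Real.exp (-3 * (1 - θ)) := by
    have hexp : θ ≤ Real.exp (θ - 1) := by linarith [Real.add_one_le_exp (θ - 1)]
    calc θ ^ 3 ≤ Real.exp (θ - 1) ^ 3 := by gcongr
      _ = Real.exp (-3 * (1 - θ)) := by
        rw [← Real.exp_nat_mul]
        congr 1
        push_cast
        ring
  have hpos : 0 < θ * (1 - θ) ^ 2 := mul_pos h0 (pow_pos (sub_pos.2 h1) 2)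
  linarith [show θ * (1 - θ) ^ 2 = θ ^ 3 - 2 * θ ^ 2 + θ by ring]
end

section
/- Let δ be a real number with 0 < δ ≤ 1/2 and let θ ∈ [0,1] be fixed. Then the function t ↦ δ + (2−t)·(1+δ)·(1 − θ^δ) − δ·θ^{1+δ}·e^{2(1−θ)(1+δ)/t} is concave on (0,∞); in particular, its value on any t ∈ [1,2] is at least the minimum of its values at t = 1 and t = 2. -/
/-- For `c ≥ 0`, the function `t ↦ exp (c / t)` is convex on the positive reals. -/
theorem convexOn_exp_div {c : ℝ} (hc : 0 ≤ c) :
    ConvexOn ℝ (Set.Ioi (0 : ℝ)) (fun t : ℝ => Real.exp (c / t)) := by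
  have hinv : ConvexOn ℝ (Set.Ioi (0 : ℝ)) (fun t : ℝ => c / t) := by
    simpa [div_eq_mul_inv] using (convexOn_zpow (𝕜 := ℝ) (-1)).smul hc
  refine ⟨convex_Ioi 0, fun x hx y hy a b ha hb hab => ?_⟩
  exact (Real.exp_le_exp.mpr (hinv.2 hx hy ha hb hab)).trans
    (convexOn_exp.2 (Set.mem_univ _) (Set.mem_univ _) ha hb hab)


/-- For `0 < δ ≤ 1/2` and fixed `θ ∈ [0,1]`, the function
`F(t) = δ + (2−t)(1+δ)(1 − θ^δ) − δ·θ^{1+δ}·e^{2(1−θ)(1+δ)/t}` is concave on `(0,∞)`;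
in particular, its value at any `t ∈ [1,2]` is at least `min (F 1) (F 2)`. -/
theorem F_concave_in_t (δ θ : ℝ)
    (hδ0 : 0 < δ) (hδ : δ ≤ 1 / 2)
    (hθ0 : 0 ≤ θ) (hθ1 : θ ≤ 1) :
    ConcaveOn ℝ (Set.Ioi (0 : ℝ)) (fun t : ℝ => δ + (2 - t) * (1 + δ) * (1 - θ ^ δ) -
        δ * θ ^ (1 + δ) * Real.exp (2 * (1 - θ) * (1 + δ) / t)) ∧
      ∀ t ∈ Set.Icc (1 : ℝ) 2,
        min (δ + (2 - 1) * (1 + δ) * (1 - θ ^ δ) -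
              δ * θ ^ (1 + δ) * Real.exp (2 * (1 - θ) * (1 + δ) / 1))
            (δ + (2 - 2) * (1 + δ) * (1 - θ ^ δ) -
              δ * θ ^ (1 + δ) * Real.exp (2 * (1 - θ) * (1 + δ) / 2)) ≤
          δ + (2 - t) * (1 + δ) * (1 - θ ^ δ) -
            δ * θ ^ (1 + δ) * Real.exp (2 * (1 - θ) * (1 + δ) / t) := by
  have hc : 0 ≤ 2 * (1 - θ) * (1 + δ) :=
    mul_nonneg (mul_nonneg zero_le_two (sub_nonneg.mpr hθ1)) (by linarith)
  have hk : 0 ≤ δ * θ ^ (1 + δ) := mul_nonneg hδ0.le (Real.rpow_nonneg hθ0 _)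
  have hconc : ConcaveOn ℝ (Set.Ioi (0 : ℝ)) (fun t : ℝ =>
      δ + (2 - t) * (1 + δ) * (1 - θ ^ δ) -
        δ * θ ^ (1 + δ) * Real.exp (2 * (1 - θ) * (1 + δ) / t)) := by
    refine ConcaveOn.sub ⟨convex_Ioi 0, fun x _ y _ a b _ _ hab => le_of_eq ?_⟩
      ((convexOn_exp_div hc).smul hk)
    obtain rfl : b = 1 - a := by linarith
    simp only [smul_eq_mul]
    ring
  exact ⟨hconc, fun t ht => hconc.min_le_of_mem_Icc (Set.mem_Ioi.mpr one_pos)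
    (Set.mem_Ioi.mpr two_pos) ht⟩
end

section
/- Let n ≥ k ≥ 2 be integers and let C_n be the (unweighted, unit-weight) cycle graph on n vertices, i.e., vertex set ℤ/nℤ with an edge of weight 1 between i and i+1 for each i. Then the minimum weight of a k-cut of C_n is λ_k = k, and the number of minimum-weight k-cuts of C_n is exactly the binomial coefficient C(n,k). -/
open Finset

namespace CycleCut

variable {n : ℕ} [NeZero n]

/-- The vertices `i` of the cycle such that the edge from `i` to `i + 1` is cut by `P`. -/
def cutEdges (P : Finpartition (univ : Finset (ZMod n))) : Finset (ZMod n) :=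
  {i | P.part i ≠ P.part (i + 1)}

theorem mem_cutEdges {P : Finpartition (univ : Finset (ZMod n))} {i : ZMod n} :
    i ∈ cutEdges P ↔ P.part i ≠ P.part (i + 1) := by
  simp [cutEdges]

theorem kCutWeight_eq_card_cutEdges {w : ZMod n → ZMod n → ℝ}
    (hw : ∀ i j : ZMod n,
      w i j = (if i + 1 = j then (1 : ℝ) else 0) + (if j + 1 = i then (1 : ℝ) else 0))
    (P : Finpartition (univ : Finset (ZMod n))) :
    kCutWeight w P = #(cutEdges P) := by
  have hsame (u v : ZMod n) : (∃ p ∈ P.parts, u ∈ p ∧ v ∈ p) ↔ P.part u = P.part v := by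
    rw [← P.mem_part_iff_exists, P.mem_part_iff_part_eq_part (mem_univ _) (mem_univ _)]
  have hterm (u v : ZMod n) :
      (if ∃ p ∈ P.parts, u ∈ p ∧ v ∈ p then (0 : ℝ) else w u v) =
        (if u + 1 = v then (if P.part u = P.part v then (0 : ℝ) else 1) else 0) +
        (if v + 1 = u then (if P.part v = P.part u then (0 : ℝ) else 1) else 0) := by
    simp only [hsame, hw, eq_comm (a := P.part v)]
    split_ifs <;> simp
  have hcard : (#(cutEdges P) : ℝ) =
      ∑ u, if P.part u = P.part (u + 1) then (0 : ℝ) else 1 := by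
    simp [cutEdges, Finset.card_filter, ite_not]
  simp only [kCutWeight, hterm, sum_add_distrib]
  rw [sum_comm (f := fun u v => if v + 1 = u then _ else _)]
  simp only [sum_ite_eq, mem_univ, if_true, hcard]
  ring

theorem exists_add_natCast_mem {D : Finset (ZMod n)} (hD : D.Nonempty) (u : ZMod n) :
    ∃ m : ℕ, u + m ∈ D := by
  obtain ⟨d, hd⟩ := hD
  exact ⟨(d - u).val, by simpa using hd⟩

/-- If some class is not all of the cycle, then the class of every vertex is left through some
cut edge. -/
theorem parts_subset_image_part_cutEdges {P : Finpartition (univ : Finset (ZMod n))}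
    (hP : 2 ≤ #P.parts) : P.parts ⊆ (cutEdges P).image P.part := by
  intro p hp
  by_contra hcut
  have hstep {u : ZMod n} (hu : P.part u = p) : P.part (u + 1) = p := by
    by_contra hne
    exact hcut (mem_image.2 ⟨u, mem_cutEdges.2 fun h => hne (h ▸ hu), hu⟩)
  obtain ⟨u, hu⟩ := P.nonempty_of_mem_parts hp
  have hall (m : ℕ) : P.part (u + m) = p := by
    induction m with
    | zero => simpa using P.part_eq_of_mem hp hu
    | succ m ih => simpa [add_assoc] using hstep ih
  have : #P.parts ≤ 1 := card_le_one_iff_subset_singleton.2 ⟨p, fun q hq => by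
    obtain ⟨v, hv⟩ := P.nonempty_of_mem_parts hq
    rw [mem_singleton, ← P.part_eq_of_mem hq hv, ← hall (v - u).val]
    simp⟩
  lia

theorem card_parts_le_card_cutEdges {P : Finpartition (univ : Finset (ZMod n))}
    (hP : 2 ≤ #P.parts) : #P.parts ≤ #(cutEdges P) :=
  (card_le_card (parts_subset_image_part_cutEdges hP)).trans card_image_le

theorem injOn_part_cutEdges {P : Finpartition (univ : Finset (ZMod n))}
    (hP : 2 ≤ #P.parts) (hcard : #(cutEdges P) = #P.parts) :
    Set.InjOn P.part (cutEdges P) :=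
  card_image_iff.1 <| le_antisymm card_image_le <|
    hcard.trans_le (card_le_card (parts_subset_image_part_cutEdges hP))

/-- The first element of `D` reached from `u` by repeatedly adding `1`. -/
def next (D : Finset (ZMod n)) (hD : D.Nonempty) (u : ZMod n) : ZMod n :=
  u + Nat.find (exists_add_natCast_mem hD u)

variable {D : Finset (ZMod n)} (hD : D.Nonempty)

theorem next_mem (u : ZMod n) : next D hD u ∈ D :=
  Nat.find_spec (exists_add_natCast_mem hD u)

theorem next_of_mem {u : ZMod n} (hu : u ∈ D) : next D hD u = u := by
  have : Nat.find (exists_add_natCast_mem hD u) = 0 := (Nat.find_eq_zero _).2 (by simpa using hu)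
  simp [next, this]

theorem next_of_notMem {u : ZMod n} (hu : u ∉ D) : next D hD u = next D hD (u + 1) := by
  have h : Nat.find (exists_add_natCast_mem hD u) =
      Nat.find (exists_add_natCast_mem hD (u + 1)) + 1 := by
    refine (Nat.find_eq_iff _).2 ⟨?_, fun m hm hmem => ?_⟩
    · have := Nat.find_spec (exists_add_natCast_mem hD (u + 1))
      push_cast
      rwa [add_comm _ (1 : ZMod n), ← add_assoc]
    · cases m with
      | zero => exact hu (by simpa using hmem)
      | succ m =>
        refine Nat.find_min (exists_add_natCast_mem hD (u + 1)) (Nat.lt_of_succ_lt_succ hm) ?_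
        rw [add_assoc, add_comm (1 : ZMod n)]
        exact_mod_cast hmem
  simp only [next, h]
  push_cast
  ring

theorem apply_next {α : Type*} {f : ZMod n → α} (hf : ∀ u ∉ D, f u = f (u + 1)) (u : ZMod n) :
    f (next D hD u) = f u := by
  obtain ⟨m, hm⟩ := exists_add_natCast_mem hD u
  induction m generalizing u with
  | zero => rw [next_of_mem hD (by simpa using hm)]
  | succ m ih =>
    by_cases hu : u ∈ D
    · rw [next_of_mem hD hu]
    · rw [next_of_notMem hD hu, hf u hu]
      refine ih (u + 1) ?_
      rw [add_assoc, add_comm (1 : ZMod n)]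
      exact_mod_cast hm

open scoped Classical in
/-- The partition of the cycle into the arcs ending at the elements of `D`. -/
noncomputable def arcs (D : Finset (ZMod n)) (hD : D.Nonempty) : Finpartition (univ : Finset (ZMod n)) :=
  Finpartition.ofSetoid (Setoid.ker (next D hD))

theorem part_arcs_eq_iff {u v : ZMod n} :
    (arcs D hD).part u = (arcs D hD).part v ↔ next D hD u = next D hD v := by
  classical
  rw [← Finpartition.mem_part_iff_part_eq_part _ (mem_univ _) (mem_univ _), arcs,
    Finpartition.mem_part_ofSetoid_iff_rel, Setoid.ker_def, eq_comm]

theorem parts_eq_image_part {V : Type*} [Fintype V] [DecidableEq V]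
    (P : Finpartition (univ : Finset V)) : P.parts = univ.image P.part := by
  ext p
  refine ⟨fun hp => ?_, fun hp => ?_⟩
  · obtain ⟨v, hv⟩ := P.nonempty_of_mem_parts hp
    exact mem_image.2 ⟨v, mem_univ v, P.part_eq_of_mem hp hv⟩
  · obtain ⟨v, -, rfl⟩ := mem_image.1 hp
    exact P.part_mem.2 (mem_univ v)

theorem card_parts_arcs : #(arcs D hD).parts = #D := by
  have himage : (arcs D hD).parts = D.image (arcs D hD).part := by
    rw [parts_eq_image_part]
    refine Subset.antisymm (fun p hp => ?_) (image_subset_image (subset_univ D))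
    obtain ⟨u, -, rfl⟩ := mem_image.1 hp
    exact mem_image.2 ⟨next D hD u, next_mem hD u,
      (part_arcs_eq_iff hD).2 (next_of_mem hD (next_mem hD u))⟩
  rw [himage, card_image_of_injOn]
  intro u hu v hv huv
  rwa [part_arcs_eq_iff, next_of_mem hD hu, next_of_mem hD hv] at huv

theorem cutEdges_arcs (hcard : 2 ≤ #D) : cutEdges (arcs D hD) = D := by
  refine eq_of_subset_of_card_le (fun u hu => ?_) ?_
  · by_contra huD
    exact mem_cutEdges.1 hu ((part_arcs_eq_iff hD).2 (next_of_notMem hD huD))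
  · rw [← card_parts_arcs hD] at hcard ⊢
    exact card_parts_le_card_cutEdges hcard

theorem eq_of_part_eq_iff {V : Type*} [Fintype V] [DecidableEq V]
    {P Q : Finpartition (univ : Finset V)}
    (h : ∀ u v, P.part u = P.part v ↔ Q.part u = Q.part v) : P = Q := by
  have hpart : P.part = Q.part := by
    ext v u
    rw [P.mem_part_iff_part_eq_part (mem_univ _) (mem_univ _), h,
      Q.mem_part_iff_part_eq_part (mem_univ _) (mem_univ _)]
  ext1
  rw [parts_eq_image_part, parts_eq_image_part, hpart]

theorem eq_arcs_cutEdges {P : Finpartition (univ : Finset (ZMod n))}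
    (hP : 2 ≤ #P.parts) (hcard : #(cutEdges P) = #P.parts) (hD : (cutEdges P).Nonempty) :
    P = arcs (cutEdges P) hD := by
  have hnext (u : ZMod n) : P.part (next (cutEdges P) hD u) = P.part u :=
    apply_next hD (fun v hv => by simpa [mem_cutEdges] using hv) u
  refine eq_of_part_eq_iff fun u v => ?_
  rw [part_arcs_eq_iff, ← hnext u, ← hnext v]
  exact (injOn_part_cutEdges hP hcard).eq_iff (next_mem hD u) (next_mem hD v)

/-- A minimum `k`-cut of the cycle is determined by its set of `k` cut edges, which is
arbitrary. -/
theorem bijOn_cutEdges {k : ℕ} (hk : 2 ≤ k) :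
    Set.BijOn cutEdges
      {P : Finpartition (univ : Finset (ZMod n)) | #P.parts = k ∧ #(cutEdges P) = k}
      (powersetCard k (univ : Finset (ZMod n))) := by
  refine ⟨fun P hP => by simpa using hP.2, fun P hP Q hQ hPQ => ?_, fun D hD => ?_⟩
  · have hne : (cutEdges P).Nonempty := card_pos.1 (by have := hP.2; lia)
    rw [eq_arcs_cutEdges (hk.trans_eq hP.1.symm) (hP.2.trans hP.1.symm) hne,
      eq_arcs_cutEdges (hk.trans_eq hQ.1.symm) (hQ.2.trans hQ.1.symm) (hPQ ▸ hne)]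
    simp only [hPQ]
  · have hDk : #D = k := by simpa using hD
    have hne : D.Nonempty := card_pos.1 (by lia)
    have hcut := cutEdges_arcs hne (hk.trans_eq hDk.symm)
    exact ⟨arcs D hne, ⟨(card_parts_arcs hne).trans hDk, by rw [hcut, hDk]⟩, hcut⟩

end CycleCut

/-- For `n ≥ k ≥ 2` and the cycle `C_n` on vertex set `ℤ/nℤ`, with an edge of weight `1`
between `i` and `i+1` for each `i` (encoded by the symmetric weight function
`w i j = [i+1 = j] + [j+1 = i]`, so that each cycle edge contributes `1` to any cut
separating its endpoints): the minimum weight of a `k`-cut is `λ_k = k`, and the number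
of minimum-weight `k`-cuts is exactly `n.choose k`. -/
theorem cycle_min_k_cut_and_count (n k : ℕ) [NeZero n] (hk : 2 ≤ k) (hn : k ≤ n)
    (w : ZMod n → ZMod n → ℝ)
    (hw : ∀ i j : ZMod n,
      w i j = (if i + 1 = j then (1 : ℝ) else 0) + (if j + 1 = i then (1 : ℝ) else 0)) :
    (∀ P : Finpartition (univ : Finset (ZMod n)), P.parts.card = k →
        (k : ℝ) ≤ kCutWeight w P) ∧
    (∃ P : Finpartition (univ : Finset (ZMod n)), P.parts.card = k ∧
        kCutWeight w P = (k : ℝ)) ∧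
    {P : Finpartition (univ : Finset (ZMod n)) |
        P.parts.card = k ∧ kCutWeight w P = (k : ℝ)}.ncard = n.choose k := by
  simp only [CycleCut.kCutWeight_eq_card_cutEdges hw, Nat.cast_le, Nat.cast_inj]
  have hbij := CycleCut.bijOn_cutEdges (n := n) hk
  refine ⟨fun P hP => ?_, ?_, ?_⟩
  · rw [← hP] at hk ⊢
    exact CycleCut.card_parts_le_card_cutEdges hk
  · obtain ⟨D, hD⟩ : (powersetCard k (univ : Finset (ZMod n))).Nonempty :=
      powersetCard_nonempty.2 (by simpa using hn)
    obtain ⟨P, hP, -⟩ := hbij.surjOn hD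
    exact ⟨P, hP⟩
  · rw [← hbij.injOn.ncard_image, hbij.image_eq, Set.ncard_coe_finset, card_powersetCard,
      card_univ, ZMod.card]
end
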